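/- Let G be a flat, finitely presented group scheme over a scheme B. Let s : Z ↪ X and t : Z ↪ Y be closed G-immersions and p : X → Y an unramified G-morphism with p ∘ s = t. Then there exists a G-invariant open subscheme U ⊆ X containing s(Z) such that the square with vertical maps s : Z ↪ U and t : Z ↪ Y and horizontal maps id_Z and p|_U : U → Y is cartesian (i.e. the projection U ×_Y Z → Z is an isomorphism, inverse to the map induced by s). If Z is quasi-compact, U may be chosen to be quasi-compact. -/

import Mathlib

open CategoryTheory CategoryTheory.Limits AlgebraicGeometry

noncomputable section

namespace EquivariantSix

universe u

instance (B : Scheme.{u}) : HasFiniteProducts (Over B) :=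
  CategoryTheory.Over.ConstructProducts.over_finiteProducts_of_finiteWidePullbacks

/-- A morphism of schemes is flat if all of its stalk maps are flat ring homomorphisms. -/
def FlatHom {X Y : Scheme.{u}} (f : X ⟶ Y) : Prop :=
  ∀ x : X, RingHom.Flat (f.stalkMap x).hom

/-- A morphism of schemes is of finite presentation if it is locally of finite presentation,
quasi-compact and quasi-separated. -/
def FinPresHom {X Y : Scheme.{u}} (f : X ⟶ Y) : Prop :=
  LocallyOfFinitePresentation f ∧ QuasiCompact f ∧ QuasiSeparated f

/-- A scheme is quasi-compact and quasi-separated. -/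
def QCQS (X : Scheme.{u}) : Prop :=
  CompactSpace X ∧ QuasiSeparatedSpace X

/-- A group scheme over a base scheme `B`, i.e. a group object in the category of
`B`-schemes (with its cartesian monoidal structure given by fibre products over `B`). -/
structure GrpOver (B : Scheme.{u}) where
  carrier : Over B
  mul : carrier ⨯ carrier ⟶ carrier
  one : ⊤_ (Over B) ⟶ carrier
  inv : carrier ⟶ carrier
  mul_assoc : prod.map mul (𝟙 carrier) ≫ mul =
    (prod.associator carrier carrier carrier).hom ≫ prod.map (𝟙 carrier) mul ≫ mul
  one_mul : prod.lift (terminal.from carrier ≫ one) (𝟙 carrier) ≫ mul = 𝟙 carrier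
  mul_one : prod.lift (𝟙 carrier) (terminal.from carrier ≫ one) ≫ mul = 𝟙 carrier
  mul_left_inv : prod.lift inv (𝟙 carrier) ≫ mul = terminal.from carrier ≫ one

/-- The underlying scheme of a group scheme. -/
def GrpOver.sch {B : Scheme.{u}} (G : GrpOver B) : Scheme.{u} := G.carrier.left

/-- The structure morphism of a group scheme. -/
def GrpOver.π {B : Scheme.{u}} (G : GrpOver B) : G.sch ⟶ B := G.carrier.hom

/-- The group scheme `G` over `B` is flat and of finite presentation. -/
def GrpOver.FlatFinPres {B : Scheme.{u}} (G : GrpOver B) : Prop :=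
  FlatHom G.π ∧ FinPresHom G.π

variable {B : Scheme.{u}} {G : GrpOver B}

/-- A `G`-scheme: a `B`-scheme equipped with an action of the group scheme `G`. -/
structure GScheme (B : Scheme.{u}) (G : GrpOver B) where
  carrier : Over B
  act : G.carrier ⨯ carrier ⟶ carrier
  one_act : prod.lift (terminal.from carrier ≫ G.one) (𝟙 carrier) ≫ act = 𝟙 carrier
  mul_act : prod.map G.mul (𝟙 carrier) ≫ act =
    (prod.associator G.carrier G.carrier carrier).hom ≫ prod.map (𝟙 G.carrier) act ≫ act

/-- The underlying scheme of a `G`-scheme. -/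
def GScheme.sch (x : GScheme B G) : Scheme.{u} := x.carrier.left

/-- The structure morphism of a `G`-scheme. -/
def GScheme.str (x : GScheme B G) : x.sch ⟶ B := x.carrier.hom

/-- A `G`-morphism, i.e. a `G`-equivariant morphism of `G`-schemes over `B`. -/
structure GHom (x y : GScheme B G) where
  hom : x.carrier ⟶ y.carrier
  equivariant : x.act ≫ hom = prod.map (𝟙 G.carrier) hom ≫ y.act

/-- The underlying morphism of schemes of a `G`-morphism. -/
def GHom.sch {x y : GScheme B G} (f : GHom x y) : x.sch ⟶ y.sch := f.hom.left

/-- The identity `G`-morphism. -/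
def GHom.id (x : GScheme B G) : GHom x x where
  hom := 𝟙 x.carrier
  equivariant := by simp

/-- Composition of `G`-morphisms. -/
def GHom.comp {x y z : GScheme B G} (f : GHom x y) (g : GHom y z) : GHom x z where
  hom := f.hom ≫ g.hom
  equivariant := by
    rw [← Category.assoc, f.equivariant, Category.assoc, g.equivariant,
      ← Category.assoc, prod.map_map, Category.comp_id]

/-- The object of `Over B` underlying a subscheme `ι : V ⟶ X` of a `G`-scheme `x`. -/
def subOver (x : GScheme B G) {V : Scheme.{u}} (ι : V ⟶ x.sch) : Over B :=
  Over.mk (ι ≫ x.str)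

/-- The morphism in `Over B` underlying a subscheme of a `G`-scheme. -/
def subHom (x : GScheme B G) {V : Scheme.{u}} (ι : V ⟶ x.sch) : subOver x ι ⟶ x.carrier :=
  Over.homMk ι rfl

/-- A subscheme `ι : V ⟶ X` of a `G`-scheme is `G`-invariant if the action
`G ×_B X → X` restricts to a morphism `G ×_B V → V`. -/
def IsInvariantSub (x : GScheme B G) {V : Scheme.{u}} (ι : V ⟶ x.sch) : Prop :=
  ∃ r : (G.carrier ⨯ subOver x ι) ⟶ subOver x ι,
    r ≫ subHom x ι = prod.map (𝟙 G.carrier) (subHom x ι) ≫ x.act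

/-- An open subscheme of a `G`-scheme is `G`-invariant if the action restricts to it. -/
def IsInvariantOpen (x : GScheme B G) (U : x.sch.Opens) : Prop :=
  IsInvariantSub x U.ι

end EquivariantSix

namespace EquivariantSix

universe u

/-- A morphism of schemes is unramified if it is locally of finite type and its diagonal is
an open immersion. -/
def IsUnramifiedHom {X Y : Scheme.{u}} (f : X ⟶ Y) : Prop :=
  LocallyOfFiniteType f ∧ IsOpenImmersion (pullback.diagonal f)

section helpers

variable {B : Scheme.{u}} {G : GrpOver B}

lemma isPullback_prod (X Y : Over B) :
    IsPullback (prod.fst : X ⨯ Y ⟶ X).left (prod.snd : X ⨯ Y ⟶ Y).left X.hom Y.hom := by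
  refine ⟨⟨by simp⟩, ⟨PullbackCone.IsLimit.mk _
    (fun c => (prod.lift (Over.homMk c.fst rfl : Over.mk (c.fst ≫ X.hom) ⟶ X)
      (Over.homMk c.snd c.condition.symm)).left) ?_ ?_ ?_⟩⟩
  · intro c
    rw [← Over.comp_left, prod.lift_fst]; rfl
  · intro c
    rw [← Over.comp_left, prod.lift_snd]; rfl
  · intro c m h1 h2
    have hm : m ≫ (X ⨯ Y).hom = c.fst ≫ X.hom := by
      rw [← h1, Category.assoc, Over.w]
    have : (Over.homMk m hm : Over.mk (c.fst ≫ X.hom) ⟶ X ⨯ Y) =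
        (prod.lift (Over.homMk c.fst rfl : Over.mk (c.fst ≫ X.hom) ⟶ X)
      (Over.homMk c.snd c.condition.symm)) := by
      apply Limits.prod.hom_ext
      · rw [prod.lift_fst]; ext1; exact h1
      · rw [prod.lift_snd]; ext1; exact h2
    exact congrArg (fun k => k.left) this

lemma isPullback_map (K : Over B) {X Y : Over B} (f : X ⟶ Y) :
    IsPullback (prod.map (𝟙 K) f).left (prod.snd : K ⨯ X ⟶ X).left
      (prod.snd : K ⨯ Y ⟶ Y).left f.left := by
  have h1 := isPullback_prod K Y
  have h2 := isPullback_prod K X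
  refine IsPullback.of_right (h₁₂ := (prod.fst : K ⨯ Y ⟶ K).left) (h₂₂ := Y.hom)
    (v₁₃ := K.hom) (h₂₁ := f.left) ?_ ?_ h1
  · rw [← Over.comp_left, prod.map_fst, Category.comp_id, Over.w]
    exact h2
  · rw [← Over.comp_left, ← Over.comp_left, prod.map_snd]

lemma pt {X Y Z W : Scheme.{u}} {f : X ⟶ Y} {g : Y ⟶ Z} {f' : X ⟶ W} {g' : W ⟶ Z}
    (e : f ≫ g = f' ≫ g') (a : X) : g (f a) = g' (f' a) := by
  rw [← Scheme.Hom.comp_apply, e, Scheme.Hom.comp_apply]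

lemma pt1 {X Y : Scheme.{u}} {f : X ⟶ Y} {g : Y ⟶ X} 
    (e : f ≫ g = 𝟙 X) (a : X) : g (f a) = a := by
  rw [← Scheme.Hom.comp_apply, e]; rfl

lemma mul_assoc' {T : Over B} (g h k : T ⟶ G.carrier) :
    prod.lift (prod.lift g h ≫ G.mul) k ≫ G.mul = prod.lift g (prod.lift h k ≫ G.mul) ≫ G.mul := by
  have := congrArg (fun q => prod.lift (prod.lift g h) k ≫ q) G.mul_assoc
  simpa [prod.lift_fst, prod.lift_snd, prod.lift_fst_assoc, prod.lift_snd_assoc, prod.comp_lift_assoc, prod.lift_map_assoc] using this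

lemma mul_act' (x : GScheme B G) {T : Over B} (g h : T ⟶ G.carrier) (k : T ⟶ x.carrier) :
    prod.lift (prod.lift g h ≫ G.mul) k ≫ x.act = prod.lift g (prod.lift h k ≫ x.act) ≫ x.act := by
  have := congrArg (fun q => prod.lift (prod.lift g h) k ≫ q) x.mul_act
  simpa [prod.lift_fst, prod.lift_snd, prod.lift_fst_assoc, prod.lift_snd_assoc, prod.comp_lift_assoc, prod.lift_map_assoc] using this

lemma one_act' (x : GScheme B G) {T : Over B} (k : T ⟶ x.carrier) :
    prod.lift (terminal.from T ≫ G.one) k ≫ x.act = k := by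
  have := congrArg (fun q => k ≫ q) x.one_act
  simpa [prod.comp_lift_assoc] using this

lemma one_mul' {T : Over B} (k : T ⟶ G.carrier) :
    prod.lift (terminal.from T ≫ G.one) k ≫ G.mul = k := by
  have := congrArg (fun q => k ≫ q) G.one_mul
  simpa [prod.comp_lift_assoc] using this

lemma inv_mul' {T : Over B} (k : T ⟶ G.carrier) :
    prod.lift (k ≫ G.inv) k ≫ G.mul = terminal.from T ≫ G.one := by
  have := congrArg (fun q => k ≫ q) G.mul_left_inv
  simpa [prod.comp_lift_assoc] using this

lemma mul_inv' {T : Over B} (k : T ⟶ G.carrier) :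
    prod.lift k (k ≫ G.inv) ≫ G.mul = terminal.from T ≫ G.one := by
  let : Mul (T ⟶ G.carrier) := ⟨fun a b => prod.lift a b ≫ G.mul⟩
  let : One (T ⟶ G.carrier) := ⟨terminal.from T ≫ G.one⟩
  let : Inv (T ⟶ G.carrier) := ⟨fun a => a ≫ G.inv⟩
  let : Group (T ⟶ G.carrier) := Group.ofLeftAxioms mul_assoc' one_mul' inv_mul'
  exact mul_inv_cancel k

/-- the shear map -/
def shear (x : GScheme B G) : (G.carrier ⨯ x.carrier) ≅ (G.carrier ⨯ x.carrier) where
  hom := prod.lift prod.fst x.act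
  inv := prod.lift prod.fst (prod.lift (prod.fst ≫ G.inv) prod.snd ≫ x.act)
  hom_inv_id := by
    have h := mul_act' x ((prod.fst : G.carrier ⨯ x.carrier ⟶ _) ≫ G.inv) prod.fst prod.snd
    rw [inv_mul', one_act'] at h
    apply Limits.prod.hom_ext
    · simp [prod.lift_fst, prod.lift_snd, prod.lift_fst_assoc, prod.lift_snd_assoc, prod.comp_lift_assoc]
    · simpa [prod.lift_fst, prod.lift_snd, prod.lift_fst_assoc, prod.lift_snd_assoc, prod.comp_lift_assoc] using h.symm
  inv_hom_id := by
    have h := mul_act' x (prod.fst : G.carrier ⨯ x.carrier ⟶ _) (prod.fst ≫ G.inv) prod.snd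
    rw [mul_inv', one_act'] at h
    apply Limits.prod.hom_ext
    · simp [prod.lift_fst, prod.lift_snd, prod.lift_fst_assoc, prod.lift_snd_assoc, prod.comp_lift_assoc]
    · simpa [prod.lift_fst, prod.lift_snd, prod.lift_fst_assoc, prod.lift_snd_assoc, prod.comp_lift_assoc] using h.symm

/-- The action map on schemes. -/
def aL (x : GScheme B G) : (G.carrier ⨯ x.carrier).left ⟶ x.sch := x.act.left

/-- The projection on schemes. -/
def pL (x : GScheme B G) : (G.carrier ⨯ x.carrier).left ⟶ x.sch :=
  (prod.snd : G.carrier ⨯ x.carrier ⟶ _).left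

lemma aL_eq (x : GScheme B G) : aL x = (shear x).hom.left ≫ pL x := by
  have : x.act = (shear x).hom ≫ prod.snd := by simp [shear, prod.lift_snd]
  exact congrArg (fun k => k.left) this

/-- Set-theoretic invariance. -/
def SInv (x : GScheme B G) (S : Set x.sch) : Prop :=
  ∀ w : (G.carrier ⨯ x.carrier).left, pL x w ∈ S → aL x w ∈ S

lemma SInv.symm {x : GScheme B G} {S : Set x.sch} (h : SInv x S)
    (w : (G.carrier ⨯ x.carrier).left) (hw : aL x w ∈ S) : pL x w ∈ S := by
  let i : G.carrier ⨯ x.carrier ⟶ G.carrier ⨯ x.carrier := prod.map G.inv (𝟙 _)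
  have e1 : pL x = ((shear x).hom ≫ i).left ≫ aL x := by
    have : prod.snd = ((shear x).hom ≫ i) ≫ x.act := by
      have h := mul_act' x ((prod.fst : G.carrier ⨯ x.carrier ⟶ _) ≫ G.inv) prod.fst prod.snd
      rw [inv_mul', one_act'] at h
      simpa [shear, i, prod.lift_map_assoc] using h
    exact congrArg (fun k => k.left) this
  have e2 : aL x = ((shear x).hom ≫ i).left ≫ pL x := by
    have : x.act = ((shear x).hom ≫ i) ≫ prod.snd := by
      simp [shear, i, prod.lift_snd]
    exact congrArg (fun k => k.left) this
  rw [e1, Scheme.Hom.comp_apply]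
  apply h
  rw [e2, Scheme.Hom.comp_apply] at hw
  exact hw

lemma SInv.open {x : GScheme B G} {U : x.sch.Opens} (h : SInv x (U : Set x.sch)) :
    IsInvariantOpen x U := by
  have hr : Set.range ((prod.map (𝟙 G.carrier) (subHom x U.ι)).left ≫ aL x) ⊆ Set.range U.ι := by
    rintro _ ⟨w, rfl⟩
    rw [Scheme.Hom.comp_apply, Scheme.Opens.range_ι]
    apply h
    have e : (prod.map (𝟙 G.carrier) (subHom x U.ι)).left ≫ pL x = 
      (prod.snd : G.carrier ⨯ subOver x U.ι ⟶ _).left ≫ U.ι := by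
      exact congrArg (fun k => k.left) (prod.map_snd (𝟙 G.carrier) (subHom x U.ι))
    have := pt e w
    rw [this]
    exact Subtype.prop _
  obtain ⟨r, hrf⟩ : ∃ r : (G.carrier ⨯ subOver x U.ι).left ⟶ U.toScheme,
      r ≫ U.ι = (prod.map (𝟙 G.carrier) (subHom x U.ι)).left ≫ aL x :=
    ⟨IsOpenImmersion.lift U.ι _ hr, IsOpenImmersion.lift_fac _ _ _⟩
  refine ⟨Over.homMk r ?_, ?_⟩
  · change r ≫ U.ι ≫ x.str = _
    rw [← Category.assoc, hrf]
    change ((prod.map (𝟙 G.carrier) (subHom x U.ι)).left ≫ x.act.left) ≫ x.carrier.hom = _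
    simp
  · ext1
    exact hrf

lemma pL_ghom {x y : GScheme B G} (f : GHom x y) :
    (prod.map (𝟙 G.carrier) f.hom).left ≫ pL y = pL x ≫ f.sch :=
  congrArg (fun k => k.left) (prod.map_snd (𝟙 G.carrier) f.hom)

lemma aL_ghom {x y : GScheme B G} (f : GHom x y) :
    (prod.map (𝟙 G.carrier) f.hom).left ≫ aL y = aL x ≫ f.sch :=
  congrArg (fun k => k.left) f.equivariant.symm

lemma SInv.range {x y : GScheme B G} (f : GHom x y) : SInv y (Set.range f.sch) := by
  rintro w ⟨v, hv⟩
  obtain ⟨q, hq, -⟩ := Scheme.exists_preimage_of_isPullback (isPullback_map G.carrier f.hom) w v hv.symm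
  refine ⟨aL x q, ?_⟩
  rw [← hq, ← Scheme.Hom.comp_apply, ← Scheme.Hom.comp_apply]
  exact congrArg (fun k => k q) (aL_ghom f).symm

lemma SInv.preimage_compl {x y : GScheme B G} (f : GHom x y) {S : Set y.sch} (h : SInv y S) :
    SInv x (f.sch ⁻¹' S)ᶜ := by
  intro w hw hw'
  apply hw
  have e1 : f.sch (pL x w) = pL y ((prod.map (𝟙 G.carrier) f.hom).left w) := by
    rw [← Scheme.Hom.comp_apply, ← Scheme.Hom.comp_apply]
    exact congrArg (fun k => k w) (pL_ghom f).symm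
  have e2 : f.sch (aL x w) = aL y ((prod.map (𝟙 G.carrier) f.hom).left w) := by
    rw [← Scheme.Hom.comp_apply, ← Scheme.Hom.comp_apply]
    exact congrArg (fun k => k w) (aL_ghom f).symm
  change f.sch (pL x w) ∈ S
  change f.sch (aL x w) ∈ S at hw'
  rw [e1]; rw [e2] at hw'
  exact h.symm _ hw'

/-- The orbit of a set. -/
def orbit (x : GScheme B G) (V : Set x.sch) : Set x.sch := aL x '' (pL x ⁻¹' V)

lemma subset_orbit (x : GScheme B G) (V : Set x.sch) : V ⊆ orbit x V := by
  intro v hv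
  let e : x.carrier ⟶ G.carrier ⨯ x.carrier := prod.lift (terminal.from x.carrier ≫ G.one) (𝟙 _)
  have e1 : e.left ≫ aL x = 𝟙 _ := congrArg (fun k => k.left) x.one_act
  have e2 : e.left ≫ pL x = 𝟙 _ := 
    congrArg (fun k => k.left) (prod.lift_snd (terminal.from x.carrier ≫ G.one) (𝟙 _))
  refine ⟨e.left v, ?_, ?_⟩
  · change pL x (e.left v) ∈ V
    have : pL x (e.left v) = v := pt1 e2 v
    rwa [this]
  · exact pt1 e1 v

lemma orbit_subset (x : GScheme B G) {V S : Set x.sch} (h : SInv x S) (hV : V ⊆ S) :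
    orbit x V ⊆ S := by
  rintro _ ⟨w, hw, rfl⟩
  exact h w (hV hw)

lemma SInv.orbit (x : GScheme B G) (V : Set x.sch) : SInv x (orbit x V) := by
  rintro w ⟨v, hv, hvw⟩
  -- lift (w, v) to G × (G × X)
  obtain ⟨q, hq, hq'⟩ := Scheme.exists_preimage_of_isPullback
    (isPullback_map G.carrier x.act) w v hvw.symm
  let m : G.carrier ⨯ (G.carrier ⨯ x.carrier) ⟶ G.carrier ⨯ x.carrier :=
    (Limits.prod.associator _ _ _).inv ≫ prod.map G.mul (𝟙 _)
  have e1 : m.left ≫ aL x = (prod.map (𝟙 G.carrier) x.act).left ≫ aL x := by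
    have : m ≫ x.act = prod.map (𝟙 G.carrier) x.act ≫ x.act := by
      rw [Category.assoc, x.mul_act, Iso.inv_hom_id_assoc]
    exact congrArg (fun k => k.left) this
  have e2 : m.left ≫ pL x = (prod.snd : G.carrier ⨯ (G.carrier ⨯ x.carrier) ⟶ _).left ≫ pL x := by
    have : m ≫ prod.snd = prod.snd ≫ prod.snd := by
      simp [m, prod.lift_snd]
    exact congrArg (fun k => k.left) this
  refine ⟨m.left q, ?_, ?_⟩
  · change pL x (m.left q) ∈ V
    have : pL x (m.left q) = pL x v := by
      rw [← hq', ← Scheme.Hom.comp_apply, ← Scheme.Hom.comp_apply]; exact congrArg (fun k => k q) e2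
    rw [this]; exact hv
  · rw [← hq, ← Scheme.Hom.comp_apply, ← Scheme.Hom.comp_apply]; exact congrArg (fun k => k q) e1

lemma orbit_isOpen (hG : G.FlatFinPres) (x : GScheme B G) {V : Set x.sch} (hV : IsOpen V) :
    IsOpen (EquivariantSix.orbit x V) := by
  have : Flat G.carrier.hom := Flat.of_stalkMap _ hG.1
  have : LocallyOfFinitePresentation G.carrier.hom := hG.2.1
  have : UniversallyOpen (pL x) := MorphismProperty.of_isPullback (P := @UniversallyOpen)
    (isPullback_prod G.carrier x.carrier) inferInstance
  have : UniversallyOpen (aL x) := by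
    rw [aL_eq]
    have : IsIso (shear x).hom.left :=
      inferInstanceAs (IsIso ((Over.forget B).map (shear x).hom))
    exact MorphismProperty.comp_mem @UniversallyOpen _ _ inferInstance ‹_›
  exact (aL x).isOpenMap _ (hV.preimage (pL x).continuous)

lemma orbit_isCompact (hG : G.FlatFinPres) (x : GScheme B G) {V : Set x.sch} (hV : IsOpen V)
    (hV' : IsCompact V) : IsCompact (EquivariantSix.orbit x V) := by
  have : QuasiCompact G.carrier.hom := hG.2.2.1
  have : QuasiCompact (pL x) := MorphismProperty.of_isPullback (P := @QuasiCompact)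
    (isPullback_prod G.carrier x.carrier) inferInstance
  exact (QuasiCompact.isCompact_preimage (f := pL x) V hV hV').image (aL x).continuous

lemma section_open {Z X Y : Scheme.{u}} (s : Z ⟶ X) (t : Z ⟶ Y) (p : X ⟶ Y)
    [IsOpenImmersion (pullback.diagonal p)] (h : s ≫ p = t) :
    IsOpenImmersion (pullback.lift (𝟙 Z) s (by simp [h]) : Z ⟶ pullback t p) := by
  subst h
  exact MorphismProperty.of_isPullback (P := @IsOpenImmersion)
    (pullback_lift_diagonal_isPullback s p) inferInstance

lemma cartesian {Z X Y : Scheme.{u}} (s : Z ⟶ X) (t : Z ⟶ Y) (p : X ⟶ Y)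
    [IsOpenImmersion (pullback.diagonal p)] [IsClosedImmersion t] (h : s ≫ p = t)
    (hr : p ⁻¹' (Set.range t) ⊆ Set.range s) :
    IsPullback (𝟙 Z) s t p := by
  have := section_open s t p h
  have : Surjective (pullback.lift (𝟙 Z) s (by simp [h]) : Z ⟶ pullback t p) := by
    refine ⟨fun q => ?_⟩
    obtain ⟨a, ha⟩ := hr (show pullback.snd t p q ∈ _ from ⟨pullback.fst t p q, by
      rw [← Scheme.Hom.comp_apply, pullback.condition, Scheme.Hom.comp_apply]⟩)
    refine ⟨a, (pullback.snd t p).isClosedEmbedding.injective ?_⟩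
    rw [← ha, ← Scheme.Hom.comp_apply, pullback.lift_snd]
  have : IsIso (pullback.lift (𝟙 Z) s (by simp [h]) : Z ⟶ pullback t p) :=
    (isIso_iff_isOpenImmersion_and_surjective _).mpr ⟨inferInstance, this⟩
  have hh : 𝟙 Z ≫ t = s ≫ p := by simp [h]
  exact IsPullback.of_iso_pullback ⟨hh⟩
    (asIso (pullback.lift (𝟙 Z) s hh : Z ⟶ pullback t p))
    (pullback.lift_fst _ _ _) (pullback.lift_snd _ _ _)

lemma isOpen_good {Z X Y : Scheme.{u}} (s : Z ⟶ X) (t : Z ⟶ Y) (p : X ⟶ Y)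
    [IsOpenImmersion (pullback.diagonal p)] [IsClosedImmersion t] (h : s ≫ p = t) :
    IsOpen (Set.range s ∪ (p ⁻¹' (Set.range t))ᶜ) := by
  have := section_open s t p h
  have hc : IsClosed (pullback.snd t p '' (Set.range
      (pullback.lift (𝟙 Z) s (by simp [h]) : Z ⟶ pullback t p))ᶜ) :=
    (pullback.snd t p).isClosedEmbedding.isClosedMap _
      (Scheme.Hom.isOpenEmbedding _).isOpen_range.isClosed_compl
  convert hc.isOpen_compl using 1
  have inj := (pullback.snd t p).isClosedEmbedding.injective
  have hr := Scheme.Pullback.range_snd (f := t) (g := p)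
  have hl (a : Z) : pullback.snd t p ((pullback.lift (𝟙 Z) s (by simp [h]) : Z ⟶ pullback t p) a)
      = s a := by rw [← Scheme.Hom.comp_apply, pullback.lift_snd]
  rw [← hr]
  ext q
  simp only [Set.mem_union, Set.mem_compl_iff, Set.mem_image, not_exists, not_and, Set.mem_range]
  constructor
  · rintro (⟨a, rfl⟩ | h') b hb hb'
    · exact hb a (inj (by rw [hl, hb']))
    · exact h' b hb'
  · intro h'
    by_contra! hcon
    obtain ⟨b, hb⟩ := hcon.2
    refine h' b ?_ hb
    intro a ha
    exact hcon.1 a (by rw [← hl, ha, hb])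

lemma main_aux {z x y : GScheme B G} (s : GHom z x) (t : GHom z y) (p : GHom x y)
    (ht : IsClosedImmersion t.sch)
    (hp : IsUnramifiedHom p.sch) (hcomm : s.hom ≫ p.hom = t.hom) (U : x.sch.Opens)
    (h1 : Set.range s.sch ⊆ (U : Set x.sch))
    (h2 : (U : Set x.sch) ⊆ Set.range s.sch ∪ (p.sch ⁻¹' (Set.range t.sch))ᶜ) :
      ∃ s' : z.sch ⟶ U.toScheme, s' ≫ U.ι = s.sch ∧
        IsPullback (𝟙 z.sch) s' t.sch (U.ι ≫ p.sch) := by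
  have hc : s.sch ≫ p.sch = t.sch := congrArg (fun k => k.left) hcomm
  have hr : Set.range s.sch ⊆ Set.range U.ι := by rwa [Scheme.Opens.range_ι]
  refine ⟨IsOpenImmersion.lift U.ι s.sch hr, IsOpenImmersion.lift_fac _ _ _, ?_⟩
  have := hp.2
  have : IsOpenImmersion (pullback.diagonal (U.ι ≫ p.sch)) :=
    MorphismProperty.comp_mem (.diagonal @IsOpenImmersion) _ _
        (inferInstanceAs (IsOpenImmersion _)) hp.2
  apply cartesian
  · rw [IsOpenImmersion.lift_fac_assoc, hc]
  · intro u hu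
    have hu' : p.sch (U.ι u) ∈ Set.range t.sch := by
      rw [← Scheme.Hom.comp_apply]; exact hu
    rcases h2 u.2 with ⟨a, ha⟩ | h
    · refine ⟨a, U.ι.isOpenEmbedding.injective ?_⟩
      rw [← Scheme.Hom.comp_apply, IsOpenImmersion.lift_fac]; exact ha
    · exact absurd hu' h

end helpers

/-- Let `G` be a flat, finitely presented group scheme over `B`.  Let
`s : Z ↪ X` and `t : Z ↪ Y` be closed `G`-immersions and `p : X → Y` an unramified
`G`-morphism with `p ∘ s = t`.  Then there exists a `G`-invariant open `U ⊆ X` containing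
`s(Z)` such that the square with vertical maps `s : Z ↪ U`, `t : Z ↪ Y` and horizontal maps
`id_Z`, `p|_U` is cartesian.  If `Z` is quasi-compact, `U` may be chosen quasi-compact. -/
theorem invariant_open_cartesian_square
    {B : Scheme.{u}} {G : GrpOver B} (hG : G.FlatFinPres)
    {z x y : GScheme B G} (s : GHom z x) (t : GHom z y) (p : GHom x y)
    (hs : IsClosedImmersion s.sch) (ht : IsClosedImmersion t.sch)
    (hp : IsUnramifiedHom p.sch) (hcomm : s.hom ≫ p.hom = t.hom) :
    (∃ U : x.sch.Opens, IsInvariantOpen x U ∧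
      ∃ s' : z.sch ⟶ U.toScheme, s' ≫ U.ι = s.sch ∧
        IsPullback (𝟙 z.sch) s' t.sch (U.ι ≫ p.sch)) ∧
    (CompactSpace z.sch →
      ∃ U : x.sch.Opens, IsCompact (U : Set x.sch) ∧ IsInvariantOpen x U ∧
        ∃ s' : z.sch ⟶ U.toScheme, s' ≫ U.ι = s.sch ∧
          IsPullback (𝟙 z.sch) s' t.sch (U.ι ≫ p.sch)) := by
  have hc : s.sch ≫ p.sch = t.sch := congrArg (fun k => k.left) hcomm
  have := hp.2
  let U : x.sch.Opens := ⟨_, isOpen_good s.sch t.sch p.sch hc⟩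
  have hU : SInv x (U : Set x.sch) := by
    rintro w (h | h)
    · exact Or.inl (SInv.range s w h)
    · exact Or.inr (SInv.preimage_compl p (SInv.range t) w h)
  have hsU : Set.range s.sch ⊆ (U : Set x.sch) := Set.subset_union_left
  refine ⟨⟨U, hU.open, main_aux s t p ht hp hcomm U hsU subset_rfl⟩, fun hz => ?_⟩
  have hcomp : IsCompact (Set.range s.sch) := isCompact_range s.sch.continuous
  obtain ⟨V, hV, hsV, hVU⟩ : ∃ V : x.sch.Opens, IsCompact (V : Set x.sch) ∧
      Set.range s.sch ⊆ (V : Set x.sch) ∧ V ≤ U := by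
    refine hcomp.induction_on (p := fun S => ∃ V : x.sch.Opens,
      IsCompact (V : Set x.sch) ∧ S ⊆ (V : Set x.sch) ∧ V ≤ U) ?_ ?_ ?_ ?_
    · exact ⟨⊥, isCompact_empty, Set.empty_subset _, bot_le⟩
    · rintro S T hST ⟨V, h1, h2, h3⟩
      exact ⟨V, h1, hST.trans h2, h3⟩
    · rintro S T ⟨V, h1, h2, h3⟩ ⟨V', h1', h2', h3'⟩
      exact ⟨V ⊔ V', h1.union h1', Set.union_subset_union h2 h2', sup_le h3 h3'⟩
    · intro a ha
      obtain ⟨_, ⟨W, hW, rfl⟩, haW, hWU⟩ :=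
        x.sch.isBasis_affineOpens.exists_subset_of_mem_open (hsU ha) U.2
      exact ⟨W, mem_nhdsWithin_of_mem_nhds (W.2.mem_nhds haW), W, hW.isCompact, subset_rfl, hWU⟩
  let O : x.sch.Opens := ⟨orbit x V, orbit_isOpen hG x V.2⟩
  have hO : SInv x (O : Set x.sch) := SInv.orbit x V
  exact ⟨O, orbit_isCompact hG x V.2 hV, hO.open, main_aux s t p ht hp hcomm O
    (hsV.trans (subset_orbit x V)) (orbit_subset x hU hVU)⟩

end EquivariantSix
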